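/- arXiv:1410.2645 — 4 statements merged into one kernel-verified Lean document; each statement's English description precedes it below -/
import Mathlib

section
/- Let F be a field, d a natural number, and let x_0, x_1, …, x_d be d + 1 pairwise distinct elements of F. Let T, T' be finite subsets of F with |T| ≤ d and |T'| ≤ d. If f_T(x_j) = f_{T'}(x_j) for every j ∈ {0, 1, …, d}, then T = T'. (A set of size at most d is uniquely determined by the sketch of its characteristic polynomial at d + 1 points.) -/
open Polynomial

/-- The characteristic polynomial of a finite set `S ⊆ F`: `∏_{α ∈ S} (X − α)`. -/
noncomputable def charPoly {F : Type*} [Field F] (S : Finset F) : F[X] :=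
  S.prod fun a => X - C a

theorem natDegree_charPoly {F : Type*} [Field F] (S : Finset F) :
    (charPoly S).natDegree = S.card := by
  simp [charPoly]

theorem roots_charPoly {F : Type*} [Field F] (S : Finset F) : (charPoly S).roots = S.val :=
  roots_prod_X_sub_C S

theorem charPoly_injective {F : Type*} [Field F] :
    Function.Injective (charPoly : Finset F → F[X]) := fun S S' h =>
  Finset.val_injective (by rw [← roots_charPoly, h, roots_charPoly])

/-- A set of size at most `d` is uniquely determined by the sketch of its characteristic
polynomial at `d + 1` pairwise distinct points: if `f_T` and `f_{T'}` agree at `d + 1`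
distinct points and `|T|, |T'| ≤ d`, then `T = T'`. -/
theorem sketch_determines_set {F : Type*} [Field F] (d : ℕ)
    (x : Fin (d + 1) → F) (hx : Function.Injective x)
    (T T' : Finset F) (hT : T.card ≤ d) (hT' : T'.card ≤ d)
    (h : ∀ j : Fin (d + 1), (charPoly T).eval (x j) = (charPoly T').eval (x j)) :
    T = T' := by
  refine charPoly_injective (eq_of_natDegree_lt_card_of_eval_eq _ _ hx h ?_)
  rw [natDegree_charPoly, natDegree_charPoly, Fintype.card_fin]
  omega
end

section
/- Let F be a field, d a natural number, and let x_0, x_1, …, x_d be d + 1 pairwise distinct elements of F. Let A, B, A', B' be finite subsets of F with A ∩ B = ∅, A' ∩ B' = ∅, |A| + |B| ≤ d, |A'| + |B'| ≤ d, and (|A| : ℤ) − (|B| : ℤ) = (|A'| : ℤ) − (|B'| : ℤ). If f_A(x_j) · f_{B'}(x_j) = f_{A'}(x_j) · f_B(x_j) for every j ∈ {0, 1, …, d}, then A = A' and B = B'. (Uniqueness of rational function interpolation used in sketch-based set reconciliation: a reduced rational function f_A/f_B with total degree at most d and known degree difference is determined by its values at d + 1 points.) -/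
open Polynomial

theorem monic_charPoly {F : Type*} [Field F] (S : Finset F) : (charPoly S).Monic :=
  monic_prod_X_sub_C id S

theorem natDegree_charPoly_mul {F : Type*} [Field F] (S T : Finset F) :
    (charPoly S * charPoly T).natDegree = S.card + T.card := by
  rw [(monic_charPoly S).natDegree_mul (monic_charPoly T), natDegree_charPoly,
    natDegree_charPoly]

theorem roots_charPoly_mul {F : Type*} [Field F] (S T : Finset F) :
    (charPoly S * charPoly T).roots = S.val + T.val := by
  rw [roots_mul ((monic_charPoly S).mul (monic_charPoly T)).ne_zero, roots_charPoly,
    roots_charPoly]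

/-- Uniqueness of rational function interpolation used in sketch-based set
reconciliation: a reduced rational function `f_A / f_B` with total degree at most `d`
and known degree difference is determined by its values at `d + 1` distinct points. -/
theorem rational_interpolation_unique {F : Type*} [Field F] [DecidableEq F] (d : ℕ)
    (x : Fin (d + 1) → F) (hx : Function.Injective x)
    (A B A' B' : Finset F) (hAB : A ∩ B = ∅) (hAB' : A' ∩ B' = ∅)
    (hcard : A.card + B.card ≤ d) (hcard' : A'.card + B'.card ≤ d)
    (hdiff : (A.card : ℤ) - (B.card : ℤ) = (A'.card : ℤ) - (B'.card : ℤ))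
    (h : ∀ j : Fin (d + 1),
      (charPoly A).eval (x j) * (charPoly B').eval (x j)
        = (charPoly A').eval (x j) * (charPoly B).eval (x j)) :
    A = A' ∧ B = B' := by
  have hpoly : charPoly A * charPoly B' = charPoly A' * charPoly B := by
    refine eq_of_natDegree_lt_card_of_eval_eq _ _ hx (fun j => by simpa using h j) ?_
    rw [natDegree_charPoly_mul, natDegree_charPoly_mul, Fintype.card_fin]
    omega
  have hcount (a : F) : (if a ∈ A then 1 else 0) + (if a ∈ B' then 1 else 0)
      = (if a ∈ A' then 1 else 0) + (if a ∈ B then 1 else 0) := by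
    have := congrArg (fun p => p.roots.count a) hpoly
    simpa [roots_charPoly_mul, Multiset.count_eq_of_nodup, Finset.nodup] using this
  have hmem (a : F) : (a ∈ A ↔ a ∈ A') ∧ (a ∈ B ↔ a ∈ B') := by
    have hA : ¬(a ∈ A ∧ a ∈ B) := by simp [← Finset.mem_inter, hAB]
    have hA' : ¬(a ∈ A' ∧ a ∈ B') := by simp [← Finset.mem_inter, hAB']
    have := hcount a
    split_ifs at this <;> simp_all
  exact ⟨Finset.ext fun a => (hmem a).1, Finset.ext fun a => (hmem a).2⟩
end

section
/- Let F be a field, N ≥ 1, and let S_1, …, S_N be finite subsets of F. Write S_∪ = ⋃_{i=1}^N S_i and S_∩ = ⋂_{i=1}^N S_i, and suppose the total set difference satisfies |S_∪ ∖ S_∩| ≤ d. Fix i ∈ {1, …, N} and let x_0, …, x_d be d + 1 pairwise distinct elements of F with x_j ∉ S_i for all j. Then T = S_∪ ∖ S_i is the unique finite subset T ⊆ F with |T| ≤ d such that f_{S_i}(x_j) · f_T(x_j) = f_{S_∪}(x_j) for every j ∈ {0, 1, …, d}. (Correctness of the relay protocol: from the broadcast sketch of S_∪ and her own sketch, party A_i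 recovers exactly the set S_∪ ∖ S_i of elements she is missing.) -/
open Polynomial

theorem degree_charPoly {F : Type*} [Field F] (S : Finset F) :
    (charPoly S).degree = S.card := by
  simp [charPoly, Polynomial.degree_prod]

theorem eval_charPoly_ne_zero {F : Type*} [Field F] {S : Finset F} {a : F} (ha : a ∉ S) :
    (charPoly S).eval a ≠ 0 := by
  rw [charPoly, Polynomial.eval_prod, Finset.prod_ne_zero_iff]
  intro b hb
  rw [eval_sub, eval_X, eval_C, sub_ne_zero]
  rintro rfl
  exact ha hb

theorem charPoly_mul_charPoly_sdiff {F : Type*} [Field F] [DecidableEq F] {A B : Finset F}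
    (h : A ⊆ B) : charPoly A * charPoly (B \ A) = charPoly B := by
  rw [mul_comm]
  exact Finset.prod_sdiff h

/-- A set of at most `d` elements is determined by the values of its characteristic polynomial
at `d + 1` distinct points. -/
theorem eq_of_eval_charPoly_eq {F : Type*} [Field F] {d : ℕ} {A B : Finset F}
    (hA : A.card ≤ d) (hB : B.card ≤ d) {x : Fin (d + 1) → F} (hx : Function.Injective x)
    (h : ∀ j, (charPoly A).eval (x j) = (charPoly B).eval (x j)) : A = B := by
  apply charPoly_injective
  refine Polynomial.eq_of_degrees_lt_of_eval_index_eq Finset.univ hx.injOn ?_ ?_ fun j _ => h j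
  · rw [degree_charPoly, Finset.card_univ, Fintype.card_fin]
    exact_mod_cast Nat.lt_succ_of_le hA
  · rw [degree_charPoly, Finset.card_univ, Fintype.card_fin]
    exact_mod_cast Nat.lt_succ_of_le hB

/-- Correctness of the relay protocol: if the total set difference
`|S_∪ ∖ S_∩| ≤ d`, then for each party `i`, the set `T = S_∪ ∖ S_i` is the unique
finite subset of `F` of size at most `d` with
`f_{S_i}(x_j) · f_T(x_j) = f_{S_∪}(x_j)` at `d + 1` distinct points `x_j ∉ S_i`. -/
theorem relay_recovers_missing {F : Type*} [Field F] [DecidableEq F]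
    (N d : ℕ) (hN : 0 < N) (S : Fin N → Finset F)
    (hd : (Finset.univ.sup S \
      Finset.univ.inf' ⟨⟨0, hN⟩, Finset.mem_univ _⟩ S).card ≤ d)
    (i : Fin N)
    (x : Fin (d + 1) → F) (hx : Function.Injective x)
    (hxS : ∀ j : Fin (d + 1), x j ∉ S i) :
    ∀ T : Finset F,
      (T.card ≤ d ∧
        ∀ j : Fin (d + 1),
          (charPoly (S i)).eval (x j) * (charPoly T).eval (x j)
            = (charPoly (Finset.univ.sup S)).eval (x j))
      ↔ T = Finset.univ.sup S \ S i := by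
  have hsub : S i ⊆ Finset.univ.sup S := Finset.le_sup (Finset.mem_univ i)
  have hcard : (Finset.univ.sup S \ S i).card ≤ d :=
    (Finset.card_le_card
      (Finset.sdiff_subset_sdiff le_rfl (Finset.inf'_le S (Finset.mem_univ i)))).trans hd
  have heval (j : Fin (d + 1)) : (charPoly (S i)).eval (x j) *
      (charPoly (Finset.univ.sup S \ S i)).eval (x j) =
        (charPoly (Finset.univ.sup S)).eval (x j) := by
    rw [← eval_mul, charPoly_mul_charPoly_sdiff hsub]
  refine fun T => ⟨fun ⟨hT, h⟩ => eq_of_eval_charPoly_eq hT hcard hx fun j => ?_, ?_⟩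
  · exact mul_left_cancel₀ (eval_charPoly_ne_zero (hxS j)) ((h j).trans (heval j).symm)
  · rintro rfl
    exact ⟨hcard, heval⟩
end

section
/- Let m, N, d be natural numbers and let S_∩ ⊆ S_i ⊆ S_∪ be finite sets of natural numbers, all of whose elements are less than m, with |S_∪ ∖ S_∩| ≤ d. Let o : ℕ → ℕ be an owner assignment with o(α) = 0 for all α ∈ S_∩ and o(α) ≤ N for all α. Define the re-encoded union Ŝ_∪ = { α + m·o(α) : α ∈ S_∪ } (the image of S_∪ under the map α ↦ α + m·o(α)). Then |Ŝ_∪ ∖ S_i| + |S_i ∖ Ŝ_∪| ≤ 2d. (After the relay re-encodes each element of S_∪ ∖ S_∩ with an owner index, the set difference between the re-encoded union and a party's own set S_i — encoded with owner label 0 — consists of at most 2d elements, so a sketch accommodating 2d differences suffices for each party to recover all missing and re-encoded elements.) -/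
/-- After the relay re-encodes each element of `S_∪` with an owner index (elements of
`S_∩` getting the dummy owner `0`), the set difference between the re-encoded union
`Ŝ_∪ = {α + m·o(α) : α ∈ S_∪}` and a party's own set `S_i` consists of at most `2d`
elements, where `d` bounds the total set difference `|S_∪ ∖ S_∩|`. -/
theorem reencoded_union_diff_le (m N d : ℕ) (Sinter Si Sunion : Finset ℕ)
    (h1 : Sinter ⊆ Si) (h2 : Si ⊆ Sunion) (hm : ∀ α ∈ Sunion, α < m)
    (hd : (Sunion \ Sinter).card ≤ d)
    (o : ℕ → ℕ) (ho0 : ∀ α ∈ Sinter, o α = 0) (hoN : ∀ α, o α ≤ N) :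
    ((Sunion.image fun α => α + m * o α) \ Si).card
      + (Si \ (Sunion.image fun α => α + m * o α)).card ≤ 2 * d := by
  have hfix : ∀ α ∈ Sinter, α + m * o α = α := fun α hα => by simp [ho0 α hα]
  have hextra : (Sunion.image fun α => α + m * o α) \ Si ⊆
      (Sunion \ Sinter).image fun α => α + m * o α := by
    intro x hx
    obtain ⟨hx, hxS⟩ := Finset.mem_sdiff.1 hx
    obtain ⟨α, hα, rfl⟩ := Finset.mem_image.1 hx
    refine Finset.mem_image_of_mem _ (Finset.mem_sdiff.2 ⟨hα, fun hαI => hxS ?_⟩)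
    rw [hfix α hαI]
    exact h1 hαI
  have hmissing : Si \ (Sunion.image fun α => α + m * o α) ⊆ Sunion \ Sinter := by
    intro x hx
    obtain ⟨hxS, hx⟩ := Finset.mem_sdiff.1 hx
    exact Finset.mem_sdiff.2
      ⟨h2 hxS, fun hxI => hx (Finset.mem_image.2 ⟨x, h2 hxS, hfix x hxI⟩)⟩
  have hextra_card := (Finset.card_le_card hextra).trans Finset.card_image_le
  have hmissing_card := Finset.card_le_card hmissing
  omega
end
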